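/- arXiv:1412.1220 — 3 statements merged into one kernel-verified Lean document; each statement's English description precedes it below -/
import Mathlib

section
/- For every z ∈ ℂ with 1/2 < Re(z) < 1, the integral ∫_0^∞ √(π/u)·(1/(e^{2√(πu)}−1) − 1/(2√(πu)))·u^{z−1} du converges and equals Γ(z)·Λ(2z−1). In particular, for every real t, ∫_0^∞ √(π/u)·(1/(e^{2√(πu)}−1) − 1/(2√(πu)))·u^{it−1/4} du = Γ(it+3/4)·Λ(1/2+2it), i.e. the completed Riemann zeta function Ξ(t) := Λ(1/2+2it) is the modified Mellin transform with parameter ν = 3/2 of the function φ(u) = √(π/u)·(1/(e^{2√(πu)}−1) − 1/(2√(πu))). -/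
open Complex Real MeasureTheory Set

open Filter Topology Asymptotics in
theorem isBigO_inv_exp_sub_one_atTop :
    (fun x : ℝ => 1 / (Real.exp x - 1)) =O[atTop] fun x => Real.exp (-1 * x) := by
  refine IsBigO.of_bound 2 ?_
  filter_upwards [eventually_ge_atTop 1] with x hx
  have h := Real.add_one_le_exp x
  rw [Real.norm_of_nonneg (by apply div_nonneg <;> linarith), Real.norm_of_nonneg (by positivity),
    neg_one_mul, Real.exp_neg, div_le_iff₀ (by linarith), mul_assoc, mul_sub,
    inv_mul_cancel₀ (Real.exp_ne_zero x)]
  have : (Real.exp x)⁻¹ ≤ 2⁻¹ := inv_anti₀ (by norm_num) (by linarith)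
  linarith

theorem abs_inv_exp_sub_one_sub_inv_le_one {x : ℝ} (hx : 0 < x) (hx1 : x ≤ 1) :
    |1 / (Real.exp x - 1) - 1 / x| ≤ 1 := by
  have h : x < Real.exp x - 1 := by linarith [Real.add_one_lt_exp hx.ne']
  have h2 := Real.abs_exp_sub_one_sub_id_le (x := x) (by rwa [abs_of_pos hx])
  rw [div_sub_div _ _ (by linarith) hx.ne', abs_div, abs_of_pos (mul_pos (hx.trans h) hx),
    div_le_one (mul_pos (hx.trans h) hx), one_mul, mul_one, abs_sub_comm]
  nlinarith

/-- The function `1 / (exp x - 1)` with its pole `1 / x` at the origin removed on `(0, 1]`. -/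
noncomputable def truncatedBoseKernel (x : ℝ) : ℂ :=
  ((1 / (Real.exp x - 1) : ℝ) : ℂ) - indicator (Ioc 0 1) (fun t : ℝ => (t : ℂ) ^ (-1 : ℂ)) x

open Filter Topology Asymptotics in
theorem truncatedBoseKernel_isBigO_atTop :
    truncatedBoseKernel =O[atTop] fun x => Real.exp (-1 * x) := by
  refine IsBigO.congr' (Complex.isBigO_ofReal_left.mpr isBigO_inv_exp_sub_one_atTop) ?_ .rfl
  filter_upwards [eventually_gt_atTop 1] with x hx
  simp [truncatedBoseKernel, hx]

open Filter Topology Asymptotics in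
theorem truncatedBoseKernel_isBigO_zero :
    truncatedBoseKernel =O[𝓝[>] 0] fun x : ℝ => x ^ (-0 : ℝ) := by
  refine IsBigO.of_bound 1 ?_
  filter_upwards [Ioc_mem_nhdsGT (zero_lt_one' ℝ)] with x hx
  rw [truncatedBoseKernel, indicator_of_mem hx, cpow_neg_one]
  rw [← Complex.ofReal_inv, ← Complex.ofReal_sub, Complex.norm_real, ← one_div x]
  simpa using! abs_inv_exp_sub_one_sub_inv_le_one hx.1 hx.2

theorem locallyIntegrableOn_truncatedBoseKernel :
    LocallyIntegrableOn truncatedBoseKernel (Ioi 0) := by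
  refine LocallyIntegrableOn.sub ?_ ?_
  · refine ContinuousOn.locallyIntegrableOn (fun x hx => ?_) measurableSet_Ioi
    have : Real.exp x - 1 ≠ 0 := by
      have := Real.add_one_lt_exp (ne_of_gt hx)
      have : (0 : ℝ) < x := hx
      linarith
    exact ContinuousAt.continuousWithinAt (by fun_prop (disch := assumption))
  · have h : LocallyIntegrableOn (fun t : ℝ => (t : ℂ) ^ (-1 : ℂ)) (Ioi 0) := by
      refine ContinuousOn.locallyIntegrableOn (fun x hx => ?_) measurableSet_Ioi
      exact (Complex.continuousAt_ofReal_cpow_const _ _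
        (Or.inr (ne_of_gt hx))).continuousWithinAt
    intro x hx
    obtain ⟨t, ht, hi⟩ := h x hx
    exact ⟨t, ht, hi.indicator measurableSet_Ioc⟩

theorem mellinConvergent_truncatedBoseKernel {s : ℂ} (hs : 0 < s.re) :
    MellinConvergent truncatedBoseKernel s :=
  mellinConvergent_of_isBigO_rpow_exp one_pos locallyIntegrableOn_truncatedBoseKernel
    truncatedBoseKernel_isBigO_atTop truncatedBoseKernel_isBigO_zero hs

theorem hasMellin_inv_exp_sub_one {s : ℂ} (hs : 1 < s.re) :
    HasMellin (fun x : ℝ => ((1 / (Real.exp x - 1) : ℝ) : ℂ)) s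
      (Complex.Gamma s * riemannZeta s) := by
  constructor
  · have h1 := mellinConvergent_truncatedBoseKernel (s := s) (by linarith)
    have h2 := (hasMellin_cpow_Ioc (-1) (s := s) (by simpa using hs)).1
    have := (hasMellin_add h1 h2).1
    simpa [truncatedBoseKernel] using! this
  · have hF : ∀ t ∈ Ioi (0 : ℝ), HasSum (fun i : ℕ => (1 : ℂ) * Real.exp (-((i : ℝ) + 1) * t))
        ((1 / (Real.exp t - 1) : ℝ) : ℂ) := by
      intro t ht
      have ht : 0 < t := ht
      have hlt : Real.exp (-t) < 1 := by simpa using ht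
      have h := (hasSum_geometric_of_lt_one (Real.exp_nonneg (-t)) hlt).mul_left (Real.exp (-t))
      have hv : Real.exp (-t) * (1 - Real.exp (-t))⁻¹ = 1 / (Real.exp t - 1) := by
        rw [Real.exp_neg]
        have := Real.one_lt_exp_iff.mpr ht
        have h1 : Real.exp t - 1 ≠ 0 := by linarith
        have h0 := Real.exp_ne_zero t
        have : 1 - (Real.exp t)⁻¹ ≠ 0 := by
          rw [sub_ne_zero]; intro h; rw [eq_comm, inv_eq_one] at h; exact h1 (by linarith)
        field_simp
      rw [hv] at h
      refine (Complex.hasSum_ofReal.mpr h).congr_fun fun i => ?_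
      rw [one_mul, ← Real.exp_nat_mul, ← Real.exp_add]
      congr 2
      ring
    have hsum : Summable fun i : ℕ => ‖(1 : ℂ)‖ / ((i : ℝ) + 1) ^ s.re := by
      have := (summable_nat_add_iff 1).mpr (Real.summable_one_div_nat_rpow.mpr hs)
      simpa using this
    have := hasSum_mellin (a := fun _ : ℕ => 1) (p := fun i : ℕ => (i : ℝ) + 1)
      (fun i => Or.inr (by positivity)) (by linarith) hF hsum
    rw [← this.tsum_eq, zeta_eq_tsum_one_div_nat_add_one_cpow hs, ← tsum_mul_left]
    simp [div_eq_mul_inv]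

theorem mellin_truncatedBoseKernel {s : ℂ} (hs : 0 < s.re) :
    (s - 1) * mellin truncatedBoseKernel s + 1 = Complex.Gamma s * riemannZeta₁ s := by
  have hopen : IsOpen {s : ℂ | 0 < s.re} := isOpen_lt continuous_const Complex.continuous_re
  have hl : AnalyticOnNhd ℂ (fun s => (s - 1) * mellin truncatedBoseKernel s + 1)
      {s : ℂ | 0 < s.re} := by
    refine DifferentiableOn.analyticOnNhd (fun s hs => ?_) hopen
    have : DifferentiableAt ℂ (mellin truncatedBoseKernel) s :=
      mellin_differentiableAt_of_isBigO_rpow_exp one_pos locallyIntegrableOn_truncatedBoseKernel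
        truncatedBoseKernel_isBigO_atTop truncatedBoseKernel_isBigO_zero hs
    exact DifferentiableAt.differentiableWithinAt (by fun_prop)
  have hr : AnalyticOnNhd ℂ (fun s => Complex.Gamma s * riemannZeta₁ s) {s : ℂ | 0 < s.re} := by
    refine DifferentiableOn.analyticOnNhd (fun s hs => ?_) hopen
    have : DifferentiableAt ℂ Complex.Gamma s := by
      refine Complex.differentiableAt_Gamma s fun m h => ?_
      have hs : 0 < s.re := hs
      rw [h] at hs
      have : (0 : ℝ) ≤ m := m.cast_nonneg
      simp at hs
      linarith
    exact DifferentiableAt.differentiableWithinAt (by fun_prop)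
  refine hl.eqOn_of_preconnected_of_eventuallyEq hr (convex_halfSpace_re_gt 0).isPreconnected
    (z₀ := 2) (by simp) ?_ hs
  have h2 : {s : ℂ | 1 < s.re} ∈ nhds (2 : ℂ) :=
    (isOpen_lt continuous_const Complex.continuous_re).mem_nhds (by simp)
  filter_upwards [h2] with s hs
  have hs : 1 < s.re := hs
  have hs1 : s - 1 ≠ 0 := by
    rw [sub_ne_zero]; rintro rfl; simp at hs
  obtain ⟨h1, h1'⟩ := hasMellin_inv_exp_sub_one hs
  obtain ⟨h3, h3'⟩ := hasMellin_cpow_Ioc (-1) (s := s) (by simpa using hs)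
  have := (hasMellin_sub h1 h3).2
  rw [h1', h3', riemannZeta_eq_inv_sub_mul (sub_ne_zero.mp hs1), ← sub_eq_add_neg] at this
  have h4 : mellin truncatedBoseKernel s = _ := this
  rw [h4]
  field_simp
  ring

theorem hasMellin_inv_exp_sub_one_sub_inv {s : ℂ} (hs : 0 < s.re) (hs1 : s.re < 1) :
    HasMellin (fun x : ℝ => ((1 / (Real.exp x - 1) - 1 / x : ℝ) : ℂ)) s
      (Complex.Gamma s * riemannZeta s) := by
  have hne : s - 1 ≠ 0 := by
    rw [sub_ne_zero]; rintro rfl; simp at hs1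
  have hexp : (s - 2).re < -1 := by simp; linarith
  have hcongr : EqOn (fun t : ℝ => (t : ℂ) ^ (s - 1) • indicator (Ioi 1) (fun t : ℝ => (t : ℂ)⁻¹) t)
      (indicator (Ioi 1) fun t : ℝ => (t : ℂ) ^ (s - 2)) (Ioi 0) := by
    intro t ht
    have ht0 : (t : ℂ) ≠ 0 := Complex.ofReal_ne_zero.mpr (ne_of_gt ht)
    by_cases h : t ∈ Ioi 1
    · simp only [indicator_of_mem h, smul_eq_mul]
      rw [← cpow_neg_one, ← cpow_add _ _ ht0]
      congr 1
      ring
    · simp [indicator_of_notMem h]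
  have htail : HasMellin (indicator (Ioi 1) (fun t : ℝ => (t : ℂ)⁻¹)) s (-1 / (s - 1)) := by
    constructor
    · rw [MellinConvergent, integrableOn_congr_fun hcongr measurableSet_Ioi]
      exact ((integrable_indicator_iff measurableSet_Ioi).mpr
        (integrableOn_Ioi_cpow_of_lt hexp one_pos)).integrableOn
    · rw [mellin, setIntegral_congr_fun measurableSet_Ioi hcongr,
        setIntegral_indicator measurableSet_Ioi, Ioi_inter_Ioi, sup_of_le_right zero_le_one,
        integral_Ioi_cpow_of_lt hexp one_pos]
      simp only [Complex.ofReal_one, one_cpow]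
      congr 1
      ring
  have hconv := mellinConvergent_truncatedBoseKernel hs
  have hsub := hasMellin_sub hconv htail.1
  have hfun : EqOn (fun t : ℝ => (t : ℂ) ^ (s - 1) • (truncatedBoseKernel t -
      indicator (Ioi 1) (fun t : ℝ => (t : ℂ)⁻¹) t))
      (fun t : ℝ => (t : ℂ) ^ (s - 1) • ((1 / (Real.exp t - 1) - 1 / t : ℝ) : ℂ)) (Ioi 0) := by
    intro t ht
    have ht : 0 < t := ht
    simp only [truncatedBoseKernel]
    congr 1
    rcases le_or_gt t 1 with h | h
    · rw [indicator_of_mem (show t ∈ Ioc 0 1 from ⟨ht, h⟩),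
        indicator_of_notMem (by simpa using h), cpow_neg_one]
      simp
    · rw [indicator_of_notMem (by simp [h]), indicator_of_mem (show t ∈ Ioi 1 from h)]
      simp
  constructor
  · exact (integrableOn_congr_fun hfun measurableSet_Ioi).mp hsub.1
  · have h := hsub.2
    rw [mellin, setIntegral_congr_fun measurableSet_Ioi hfun, ← mellin, htail.2] at h
    rw [h, riemannZeta_eq_inv_sub_mul (sub_ne_zero.mp hne)]
    have := mellin_truncatedBoseKernel hs
    field_simp
    linear_combination this

theorem hasMellin_comp_two_mul_sqrt {g : ℝ → ℂ} {z m : ℂ} (hg : HasMellin g (2 * z - 1) m) :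
    HasMellin (fun u => g (2 * Real.sqrt π * u ^ (1 / 2 : ℝ))) (z - 1 / 2)
      (2 * ((2 * Real.sqrt π : ℝ) : ℂ) ^ (-(2 * z - 1)) * m) := by
  have ha : (0 : ℝ) < 2 * Real.sqrt π := by positivity
  have hz : (z - 1 / 2) / ((1 / 2 : ℝ) : ℂ) = 2 * z - 1 := by
    push_cast
    ring
  constructor
  · rw [MellinConvergent.comp_rpow (f := fun t => g (2 * Real.sqrt π * t)) (by norm_num), hz,
      MellinConvergent.comp_mul_left ha]
    exact hg.1
  · rw [mellin_comp_rpow (fun t => g (2 * Real.sqrt π * t)), hz, mellin_comp_mul_left _ _ ha, hg.2]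
    rw [abs_of_pos (by norm_num), Complex.real_smul, smul_eq_mul]
    push_cast
    ring

theorem Gamma_mul_completedRiemannZeta_eq {z : ℂ} (hz : 1 / 2 < z.re) :
    Complex.Gamma z * completedRiemannZeta (2 * z - 1) =
      Real.sqrt π * (2 * ((2 * Real.sqrt π : ℝ) : ℂ) ^ (-(2 * z - 1)) *
        (Complex.Gamma (2 * z - 1) * riemannZeta (2 * z - 1))) := by
  have hre : 0 < (2 * z - 1).re := by simp; linarith
  have hne : 2 * z - 1 ≠ 0 := by
    intro h; rw [h] at hre; simp at hre
  have hG := Complex.Gammaℝ_ne_zero_of_re_pos hre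
  have hdup := Complex.Gamma_mul_Gamma_add_half (z - 1 / 2)
  rw [sub_add_cancel, show 2 * (z - 1 / 2) = 2 * z - 1 by ring,
    show (1 : ℂ) - (2 * z - 1) = 1 + -(2 * z - 1) by ring, cpow_add _ _ two_ne_zero, cpow_one]
    at hdup
  have hpow : ((2 * Real.sqrt π : ℝ) : ℂ) ^ (-(2 * z - 1)) =
      2 ^ (-(2 * z - 1)) * (π : ℂ) ^ (-(2 * z - 1) / 2) := by
    rw [Complex.ofReal_mul, mul_cpow_ofReal_nonneg zero_le_two (Real.sqrt_nonneg π),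
      Real.sqrt_eq_rpow, ← cpow_mul_ofReal_nonneg pi_pos.le]
    push_cast
    congr 2
    ring
  rw [riemannZeta_def_of_ne_zero hne, hpow, ← mul_div_assoc, ← mul_div_assoc, ← mul_div_assoc,
    eq_div_iff hG, Gammaℝ_def, show (2 * z - 1) / 2 = z - 1 / 2 by ring]
  linear_combination completedRiemannZeta (2 * z - 1) * (π : ℂ) ^ (-(2 * z - 1) / 2) * hdup

theorem eqOn_mellin_integrand_two_mul_sqrt (z : ℂ) :
    EqOn (fun u : ℝ => (Real.sqrt π : ℂ) * ((u : ℂ) ^ (z - 1 / 2 - 1) •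
        ((1 / (Real.exp (2 * Real.sqrt π * u ^ (1 / 2 : ℝ)) - 1) -
          1 / (2 * Real.sqrt π * u ^ (1 / 2 : ℝ)) : ℝ) : ℂ)))
      (fun u : ℝ =>
        ((Real.sqrt (π / u) *
            (1 / (Real.exp (2 * Real.sqrt (π * u)) - 1) - 1 / (2 * Real.sqrt (π * u))) : ℝ) : ℂ) *
          (u : ℂ) ^ (z - 1)) (Ioi 0) := by
  intro u hu
  have hu : 0 < u := hu
  have hu0 : (u : ℂ) ≠ 0 := Complex.ofReal_ne_zero.mpr hu.ne'
  have hpow : (u : ℂ) ^ (z - 1 / 2 - 1) = (u : ℂ) ^ (z - 1) * ((Real.sqrt u : ℝ) : ℂ)⁻¹ := by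
    rw [show z - 1 / 2 - 1 = (z - 1) + -(1 / 2) by ring, cpow_add _ _ hu0, cpow_neg,
      Real.sqrt_eq_rpow, Complex.ofReal_cpow hu.le]
    push_cast
    rfl
  simp only
  rw [hpow, ← Real.sqrt_eq_rpow, Real.sqrt_mul pi_pos.le, Real.sqrt_div pi_pos.le, mul_assoc 2,
    smul_eq_mul, Complex.ofReal_mul (Real.sqrt π / Real.sqrt u), Complex.ofReal_div]
  ring

/-- The completed Riemann zeta function as a (modified) Mellin transform:
for `1/2 < Re z < 1`, `∫_0^∞ √(π/u)(1/(e^{2√(πu)}−1) − 1/(2√(πu))) u^{z−1} du = Γ(z)Λ(2z−1)`,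
the integral being convergent; in particular, for every real `t`,
`∫_0^∞ √(π/u)(1/(e^{2√(πu)}−1) − 1/(2√(πu))) u^{it−1/4} du = Γ(it+3/4)·Λ(1/2+2it)`. -/
theorem stmt_9 :
    (∀ z : ℂ, 1 / 2 < z.re → z.re < 1 →
      IntegrableOn (fun u : ℝ =>
        ((Real.sqrt (π / u) *
            (1 / (Real.exp (2 * Real.sqrt (π * u)) - 1) - 1 / (2 * Real.sqrt (π * u))) : ℝ) : ℂ) *
          (u : ℂ) ^ (z - 1)) (Ioi 0) ∧
      (∫ u in Ioi (0 : ℝ),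
          ((Real.sqrt (π / u) *
              (1 / (Real.exp (2 * Real.sqrt (π * u)) - 1) - 1 / (2 * Real.sqrt (π * u))) : ℝ) : ℂ) *
            (u : ℂ) ^ (z - 1))
        = Complex.Gamma z * completedRiemannZeta (2 * z - 1)) ∧
    (∀ t : ℝ,
      (∫ u in Ioi (0 : ℝ),
          ((Real.sqrt (π / u) *
              (1 / (Real.exp (2 * Real.sqrt (π * u)) - 1) - 1 / (2 * Real.sqrt (π * u))) : ℝ) : ℂ) *
            (u : ℂ) ^ (I * t - 1 / 4))
        = Complex.Gamma (I * t + 3 / 4) * completedRiemannZeta (1 / 2 + 2 * I * t)) := by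
  refine (and_iff_left_of_imp fun main t => ?_).mpr fun z hz hz1 => ?_
  · have h := (main (I * t + 3 / 4) (by norm_num) (by norm_num)).2
    rw [show I * (t : ℂ) + 3 / 4 - 1 = I * t - 1 / 4 by ring,
      show 2 * (I * (t : ℂ) + 3 / 4) - 1 = 1 / 2 + 2 * I * t by ring] at h
    exact h
  · obtain ⟨hint, hval⟩ := hasMellin_comp_two_mul_sqrt
      (hasMellin_inv_exp_sub_one_sub_inv (s := 2 * z - 1) (by simp; linarith) (by simp; linarith))
    constructor
    · rw [← integrableOn_congr_fun (eqOn_mellin_integrand_two_mul_sqrt z) measurableSet_Ioi]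
      exact Integrable.const_mul hint (Real.sqrt π : ℂ)
    · rw [← setIntegral_congr_fun measurableSet_Ioi (eqOn_mellin_integrand_two_mul_sqrt z),
        integral_const_mul, Gamma_mul_completedRiemannZeta_eq hz, ← hval]
      rfl
end

section
/- Let χ₄ be the unique primitive Dirichlet character modulo 4 (χ₄(1 mod 4) = 1, χ₄(3 mod 4) = −1) and let L(·, χ₄) be its Dirichlet L-function (the analytic continuation of Σ_{n≥1} χ₄(n)·n^{−s}). Then for every z ∈ ℂ with Re(z) > 0, the integral ∫_0^∞ (1/2)·sech(√(πu))·u^{z−1} du converges and equals 2·π^{−z}·Γ(2z)·L(2z, χ₄). -/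
open Complex Real MeasureTheory Set

/-- The primitive Dirichlet character modulo 4 (`χ₄(1) = 1`, `χ₄(3) = −1`), ℂ-valued. -/
noncomputable def chi4 : DirichletCharacter ℂ 4 := ZMod.χ₄.ringHomComp (Int.castRingHom ℂ)

open Filter Asymptotics Topology in
lemma isBigO_half_sech_atTop :
    (fun t : ℝ => ((1 / 2 * (1 / Real.cosh t) : ℝ) : ℂ)) =O[atTop] fun t => rexp (-1 * t) := by
  refine IsBigO.of_bound 1 (Eventually.of_forall fun t => ?_)
  have hc := Real.cosh_pos t
  have h1 : rexp t * rexp (-1 * t) = 1 := by rw [← Real.exp_add]; simp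
  have h2 : 0 < rexp (-1 * t) := Real.exp_pos _
  have h3 : rexp t ≤ 2 * Real.cosh t := by
    rw [Real.cosh_eq]
    linarith [Real.exp_pos (-t)]
  rw [norm_real, Real.norm_of_nonneg (by positivity), Real.norm_of_nonneg h2.le, one_mul,
    one_div_mul_one_div, div_le_iff₀ (by positivity)]
  nlinarith

open Filter Asymptotics Topology in
lemma isBigO_half_sech_zero :
    (fun t : ℝ => ((1 / 2 * (1 / Real.cosh t) : ℝ) : ℂ)) =O[𝓝[>] 0] fun t : ℝ => t ^ (-0 : ℝ) := by
  refine IsBigO.of_bound 1 (Eventually.of_forall fun t => ?_)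
  have hc := Real.one_le_cosh t
  have h : 1 / Real.cosh t ≤ 1 := by
    rw [div_le_one (by positivity)]
    exact hc
  rw [norm_real, Real.norm_of_nonneg (by positivity)]
  simp only [neg_zero, Real.rpow_zero, norm_one]
  linarith

lemma continuous_half_sech :
    Continuous (fun t : ℝ => ((1 / 2 * (1 / Real.cosh t) : ℝ) : ℂ)) := by
  refine continuous_ofReal.comp (continuous_const.mul ?_)
  exact continuous_const.div Real.continuous_cosh fun t => (Real.cosh_pos t).ne'

lemma mellinConvergent_half_sech {s : ℂ} (hs : 0 < s.re) :
    MellinConvergent (fun t : ℝ => ((1 / 2 * (1 / Real.cosh t) : ℝ) : ℂ)) s :=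
  mellinConvergent_of_isBigO_rpow_exp one_pos
    (continuous_half_sech.locallyIntegrable.locallyIntegrableOn _)
    isBigO_half_sech_atTop isBigO_half_sech_zero hs

lemma differentiableAt_mellin_half_sech {s : ℂ} (hs : 0 < s.re) :
    DifferentiableAt ℂ (mellin fun t : ℝ => ((1 / 2 * (1 / Real.cosh t) : ℝ) : ℂ)) s :=
  mellin_differentiableAt_of_isBigO_rpow_exp one_pos
    (continuous_half_sech.locallyIntegrable.locallyIntegrableOn _)
    isBigO_half_sech_atTop isBigO_half_sech_zero hs

lemma chi4_two_mul_add_one (k : ℕ) : chi4 ((2 * k + 1 : ℕ) : ZMod 4) = (-1) ^ k := by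
  have h := ZMod.χ₄_eq_neg_one_pow (n := 2 * k + 1) (by omega)
  rw [show (2 * k + 1) / 2 = k by omega] at h
  rw [chi4, MulChar.ringHomComp_apply, h]
  simp

lemma chi4_eq_zero_of_even {n : ℕ} (hn : Even n) : chi4 (n : ZMod 4) = 0 := by
  rw [chi4, MulChar.ringHomComp_apply, ZMod.χ₄_nat_eq_if_mod_four,
    if_pos (Nat.even_iff.mp hn), map_zero]

lemma chi4_ne_one : chi4 ≠ 1 := by
  intro h
  have h1 := chi4_two_mul_add_one 1
  have hu : IsUnit ((2 * 1 + 1 : ℕ) : ZMod 4) := by decide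
  rw [h, MulChar.one_apply hu] at h1
  norm_num at h1

/-- Expansion of the hyperbolic secant in powers of `e^{-t}`. -/
lemma hasSum_chi4_mul_exp {t : ℝ} (ht : 0 < t) :
    HasSum (fun n : ℕ => chi4 (n : ZMod 4) * (rexp (-(n : ℝ) * t) : ℂ))
      ((1 / 2 * (1 / Real.cosh t) : ℝ) : ℂ) := by
  have hinj : Function.Injective fun k : ℕ => 2 * k + 1 := fun a b h => by simpa using h
  rw [← hinj.hasSum_iff]
  · have hlt : ‖-rexp (-2 * t)‖ < 1 := by
      rw [norm_neg, Real.norm_of_nonneg (Real.exp_pos _).le, Real.exp_lt_one_iff]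
      linarith
    have hreal := (hasSum_geometric_of_norm_lt_one hlt).mul_left (rexp (-t))
    have hval : rexp (-t) * (1 - -rexp (-2 * t))⁻¹ = 1 / 2 * (1 / Real.cosh t) := by
      have h1 : rexp (-2 * t) = rexp (-t) * rexp (-t) := by rw [← Real.exp_add]; ring_nf
      have h2 : rexp t * rexp (-t) = 1 := by rw [← Real.exp_add]; simp
      have h3 := Real.exp_pos (-t)
      have h4 := Real.exp_pos t
      have h5 : 1 - -(rexp (-t) * rexp (-t)) = rexp (-t) * (rexp t + rexp (-t)) := by
        linear_combination -h2
      rw [Real.cosh_eq, h1, h5]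
      field_simp
    rw [hval] at hreal
    convert! hasSum_ofReal.mpr hreal using 2 with k
    simp only [Function.comp_apply]
    rw [chi4_two_mul_add_one, neg_pow (rexp _), ← Real.exp_nat_mul, mul_left_comm, ← Real.exp_add]
    push_cast
    ring_nf
  · intro n hn
    rw [chi4_eq_zero_of_even, zero_mul]
    by_contra h
    obtain ⟨k, hk⟩ := Nat.not_even_iff_odd.mp h
    exact hn ⟨k, hk.symm⟩

lemma mellin_half_sech_of_one_lt_re {s : ℂ} (hs : 1 < s.re) :
    mellin (fun t : ℝ => ((1 / 2 * (1 / Real.cosh t) : ℝ) : ℂ)) s =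
      Complex.Gamma s * DirichletCharacter.LFunction chi4 s := by
  have hs0 : s ≠ 0 := by
    rintro rfl
    norm_num at hs
  have hsum : LSeriesSummable (fun n : ℕ => chi4 (n : ZMod 4)) s :=
    DirichletCharacter.LSeriesSummable_of_one_lt_re chi4 hs
  have h := hasSum_mellin (a := fun n : ℕ => chi4 (n : ZMod 4)) (p := fun n : ℕ => (n : ℝ))
    (s := s) (fun n => ?_) (by linarith) (fun t ht => hasSum_chi4_mul_exp ht) ?_
  · rw [← h.tsum_eq, DirichletCharacter.LFunction_eq_LSeries _ hs, LSeries, ← tsum_mul_left]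
    refine tsum_congr fun n => ?_
    rw [LSeries.term_of_ne_zero' hs0, ofReal_natCast, mul_div_assoc]
  · rcases Nat.eq_zero_or_pos n with rfl | hn
    · exact Or.inl (chi4_eq_zero_of_even Even.zero)
    · exact Or.inr (Nat.cast_pos.mpr hn)
  · refine hsum.norm.congr fun n => ?_
    rw [LSeries.term_of_ne_zero' hs0, norm_div]
    rcases Nat.eq_zero_or_pos n with rfl | hn
    · rw [chi4_eq_zero_of_even Even.zero, norm_zero, zero_div, zero_div]
    · rw [Complex.norm_natCast_cpow_of_pos hn]

lemma mellin_half_sech {s : ℂ} (hs : 0 < s.re) :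
    mellin (fun t : ℝ => ((1 / 2 * (1 / Real.cosh t) : ℝ) : ℂ)) s =
      Complex.Gamma s * DirichletCharacter.LFunction chi4 s := by
  have hopen : IsOpen {c : ℂ | 0 < c.re} := isOpen_lt continuous_const continuous_re
  have hf : DifferentiableOn ℂ (mellin fun t : ℝ => ((1 / 2 * (1 / Real.cosh t) : ℝ) : ℂ))
      {c : ℂ | 0 < c.re} := fun c hc =>
    (differentiableAt_mellin_half_sech hc).differentiableWithinAt
  have hg : DifferentiableOn ℂ
      (fun s => Complex.Gamma s * DirichletCharacter.LFunction chi4 s) {c : ℂ | 0 < c.re} := by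
    intro c hc
    refine DifferentiableAt.differentiableWithinAt (DifferentiableAt.mul ?_
      (DirichletCharacter.differentiable_LFunction chi4_ne_one c))
    refine Complex.differentiableAt_Gamma c fun m hm => ?_
    have hc' : 0 < c.re := hc
    rw [hm] at hc'
    simp only [neg_re, natCast_re, Left.neg_pos_iff] at hc'
    exact absurd hc' (Nat.cast_nonneg m).not_gt
  refine (hf.analyticOnNhd hopen).eqOn_of_preconnected_of_eventuallyEq (hg.analyticOnNhd hopen)
    (convex_halfSpace_re_gt 0).isPreconnected (z₀ := 2) (by simp) ?_ hs
  filter_upwards [(isOpen_lt continuous_const continuous_re).mem_nhds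
    (show (1 : ℝ) < (2 : ℂ).re by norm_num)] with c hc
  exact mellin_half_sech_of_one_lt_re hc

/-- For `Re z > 0`,
`∫_0^∞ (1/2) sech(√(πu)) u^{z−1} du = 2 π^{−z} Γ(2z) L(2z, χ₄)`,
the integral being convergent. -/
theorem stmt_10 (z : ℂ) (hz : 0 < z.re) :
    IntegrableOn (fun u : ℝ =>
      ((1 / 2 * (1 / Real.cosh (Real.sqrt (π * u))) : ℝ) : ℂ) * (u : ℂ) ^ (z - 1)) (Ioi 0) ∧
    (∫ u in Ioi (0 : ℝ),
        ((1 / 2 * (1 / Real.cosh (Real.sqrt (π * u))) : ℝ) : ℂ) * (u : ℂ) ^ (z - 1))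
      = 2 * (π : ℂ) ^ (-z) * Complex.Gamma (2 * z) *
          DirichletCharacter.LFunction chi4 (2 * z) := by
  have h2z : z / ((1 / 2 : ℝ) : ℂ) = 2 * z := by
    push_cast
    ring
  have hre : 0 < (2 * z).re := by simpa using hz
  simp_rw [Real.sqrt_eq_rpow, mul_comm _ ((_ : ℂ) ^ (z - 1))]
  constructor
  · refine (MellinConvergent.comp_mul_left (s := z) (f := fun u : ℝ =>
      ((1 / 2 * (1 / Real.cosh (u ^ (1 / 2 : ℝ))) : ℝ) : ℂ)) pi_pos).mpr ?_
    refine (MellinConvergent.comp_rpow (f := fun u : ℝ =>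
      ((1 / 2 * (1 / Real.cosh u) : ℝ) : ℂ)) (by norm_num : (1 / 2 : ℝ) ≠ 0)).mpr ?_
    rw [h2z]
    exact mellinConvergent_half_sech hre
  · refine (mellin_comp_mul_left (fun u : ℝ =>
      ((1 / 2 * (1 / Real.cosh (u ^ (1 / 2 : ℝ))) : ℝ) : ℂ)) z pi_pos).trans ?_
    rw [mellin_comp_rpow (fun u : ℝ => ((1 / 2 * (1 / Real.cosh u) : ℝ) : ℂ)), h2z,
      mellin_half_sech hre, abs_of_pos (by norm_num : (0 : ℝ) < 1 / 2), real_smul, smul_eq_mul]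
    push_cast
    ring
end

section
/- Let ν > 0, n ≥ 2, and a₀, …, a_n ∈ ℂ with a_n ≠ 0, and let B_n be the associated companion matrix. Then tr(B_n²) = −2·Σ_{k=1}^{n−1} k(k+ν−1) − 2n(n−1)·(a_{n−2}/a_n) + n²·(a_{n−1}/a_n)². -/
open Complex Real Finset

/-- The tridiagonal matrix `H_n` with zero diagonal, subdiagonal entries
`(H_n)_{j+1,j} = j+ν−1` and superdiagonal entries `(H_n)_{j,j+1} = −j` (1-based indexing). -/
noncomputable def Hmat (ν : ℝ) (n : ℕ) : Matrix (Fin n) (Fin n) ℂ :=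
  Matrix.of fun i j : Fin n =>
    if (i : ℕ) = (j : ℕ) + 1 then ((j : ℕ) : ℂ) + ν
    else if (j : ℕ) = (i : ℕ) + 1 then -(((i : ℕ) : ℂ) + 1)
    else 0

/-- The companion matrix `B_n = H_n + (n/a_n)·e_n·(a₀,…,a_{n−1})`, i.e. `H_n` with
`n·a_{j−1}/a_n` added to the `(n,j)` entry (1-based indexing). -/
noncomputable def Bmat (ν : ℝ) (n : ℕ) (a : ℕ → ℂ) : Matrix (Fin n) (Fin n) ℂ :=
  Hmat ν n + Matrix.of fun i j : Fin n =>
    if (i : ℕ) = n - 1 then ((n : ℂ) / a n) * a (j : ℕ) else 0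

/-- A double sum over the square `[0, m]²` of a kernel supported on the two diagonals adjacent to
the main one. -/
theorem sum_range_sum_range_of_adjacent {M : Type*} [AddCommMonoid M] (g : ℕ → ℕ → M)
    (hg : ∀ i j, i ≠ j + 1 → j ≠ i + 1 → g i j = 0) (m : ℕ) :
    ∑ i ∈ range (m + 1), ∑ j ∈ range (m + 1), g i j
      = ∑ k ∈ range m, (g k (k + 1) + g (k + 1) k) := by
  induction m with
  | zero => simpa using hg 0 0 (by simp) (by simp)
  | succ m ih =>
    have hrow : ∑ j ∈ range (m + 1), g (m + 1) j = g (m + 1) m := by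
      refine sum_eq_single m (fun j hj hjm => hg _ _ (by omega) ?_) (by simp)
      have := mem_range.mp hj
      omega
    have hcol : ∑ i ∈ range (m + 1), g i (m + 1) = g m (m + 1) := by
      refine sum_eq_single m (fun i hi him => hg _ _ ?_ (by omega)) (by simp)
      have := mem_range.mp hi
      omega
    rw [sum_range_succ _ (m + 1)]
    simp only [sum_range_succ _ (m + 1), sum_add_distrib] at ih ⊢
    rw [ih, hrow, hcol, hg (m + 1) (m + 1) (by omega) (by omega), add_zero]
    rw [sum_range_succ, sum_range_succ]
    abel

theorem trace_Hmat_mul_self (ν : ℝ) (m : ℕ) :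
    Matrix.trace (Hmat ν (m + 1) * Hmat ν (m + 1))
      = -2 * ∑ k ∈ range m, ((k : ℂ) + 1) * ((k : ℂ) + ν) := by
  let h : ℕ → ℕ → ℂ := fun i j =>
    if i = j + 1 then (j : ℂ) + ν else if j = i + 1 then -((i : ℂ) + 1) else 0
  have htrace : Matrix.trace (Hmat ν (m + 1) * Hmat ν (m + 1))
      = ∑ i ∈ range (m + 1), ∑ j ∈ range (m + 1), h i j * h j i := by
    simp only [sum_range]
    rfl
  rw [htrace, sum_range_sum_range_of_adjacent (fun i j => h i j * h j i) _ m, mul_sum]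
  · refine sum_congr rfl fun k _ => ?_
    have hsup : h k (k + 1) = -((k : ℂ) + 1) := by simp [h, add_assoc]
    have hsub : h (k + 1) k = (k : ℂ) + ν := by simp [h]
    simp only [hsup, hsub]
    ring
  · intro i j hij hji
    simp [h, hij, hji]

theorem Bmat_eq_Hmat_add_vecMulVec (ν : ℝ) (m : ℕ) (a : ℕ → ℂ) :
    Bmat ν (m + 1) a = Hmat ν (m + 1) + Matrix.vecMulVec (Pi.single (Fin.last m) 1)
      (fun j : Fin (m + 1) => ((m + 1 : ℕ) : ℂ) / a (m + 1) * a j) := by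
  unfold Bmat
  congr 1
  ext i j
  simp [Matrix.vecMulVec_apply, Pi.single_apply, Fin.ext_iff]

theorem vecMul_Hmat_last (ν : ℝ) (m : ℕ) (r : Fin (m + 2) → ℂ) :
    Matrix.vecMul r (Hmat ν (m + 2)) (Fin.last (m + 1))
      = -((m : ℂ) + 1) * r (Fin.last m).castSucc := by
  rw [Matrix.vecMul, dotProduct, Finset.sum_eq_single (Fin.last m).castSucc]
  · simp [Hmat, mul_comm, add_assoc]
  · intro i _ hi
    have hne : (i : ℕ) ≠ m := fun h => hi (Fin.ext h)
    have hlt := i.isLt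
    simp [Hmat, show m ≠ (i : ℕ) by omega, show (i : ℕ) ≠ m + 1 + 1 by omega]
  · simp

/-- Trace of the square of the companion matrix:
`tr(B_n²) = −2 Σ_{k=1}^{n−1} k(k+ν−1) − 2n(n−1)(a_{n−2}/a_n) + n²(a_{n−1}/a_n)²`. -/
theorem stmt_14 (ν : ℝ) (hν : 0 < ν) (n : ℕ) (hn : 2 ≤ n) (a : ℕ → ℂ) (han : a n ≠ 0) :
    Matrix.trace (Bmat ν n a * Bmat ν n a)
      = -2 * (∑ k ∈ Finset.range (n - 1), (((k : ℕ) + 1 : ℂ) * (((k : ℕ) + 1 : ℂ) + ν - 1)))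
        - 2 * n * (n - 1) * (a (n - 2) / a n) + (n : ℂ) ^ 2 * (a (n - 1) / a n) ^ 2 := by
  obtain ⟨m, rfl⟩ : ∃ m, n = m + 2 := ⟨n - 2, by omega⟩
  have hsum : ∑ k ∈ range (m + 1), ((k : ℂ) + 1) * ((k : ℂ) + 1 + ν - 1)
      = ∑ k ∈ range (m + 1), ((k : ℂ) + 1) * ((k : ℂ) + ν) :=
    sum_congr rfl fun k _ => by ring
  rw [Bmat_eq_Hmat_add_vecMulVec]
  set r : Fin (m + 2) → ℂ := fun j => ((m + 1 + 1 : ℕ) : ℂ) / a (m + 1 + 1) * a j with hr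
  set e : Fin (m + 2) → ℂ := Pi.single (Fin.last (m + 1)) 1 with he
  have hcross : Matrix.trace (Matrix.vecMulVec e r * Hmat ν (m + 2))
      = -((m : ℂ) + 1) * r (Fin.last m).castSucc := by
    rw [Matrix.vecMulVec_mul, Matrix.trace_vecMulVec, he, single_one_dotProduct, vecMul_Hmat_last]
  have hsq : Matrix.trace (Matrix.vecMulVec e r * Matrix.vecMulVec e r)
      = r (Fin.last (m + 1)) ^ 2 := by
    rw [Matrix.vecMulVec_mul_vecMulVec, Matrix.trace_vecMulVec, he, single_one_dotProduct,
      dotProduct_single_one]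
    simp [sq]
  rw [add_mul, mul_add, mul_add, Matrix.trace_add, Matrix.trace_add, Matrix.trace_add,
    Matrix.trace_mul_comm (Hmat ν (m + 2)) (Matrix.vecMulVec e r), hcross, hsq,
    trace_Hmat_mul_self, show m + 2 - 1 = m + 1 by omega, hsum, Nat.add_sub_cancel]
  simp only [hr, Fin.val_castSucc, Fin.val_last]
  push_cast
  ring
end
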